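/- Let V be a normed space, let V₀ be a dense linear subspace of V, and let W be a closed linear subspace of V such that V₀ ∩ W is dense in W. Then the natural linear map from the quotient V₀/(V₀ ∩ W) (with the quotient norm induced from the norm of V restricted to V₀) to the quotient V/W (with its quotient norm), sending v + (V₀ ∩ W) to v + W, is a linear isometry, and its range is dense in V/W. -/

import Mathlib

/-- **Lemma 1.1 (Banach-space version).**
Let `V` be a normed space (over `ℝ` or `ℂ`, here over an `RCLike` field `𝕜`),
`V₀` a dense linear subspace of `V`, and `W` a closed linear subspace of `V`
such that `V₀ ∩ W` is dense in `W`.  Then the natural linear map from the quotient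
`V₀ / (V₀ ∩ W)` (with the quotient norm induced from the norm of `V` restricted to `V₀`)
to `V / W` (with its quotient norm), sending `v + (V₀ ∩ W)` to `v + W`, is a linear
isometry with dense range. -/
theorem quotient_embedding_isometric_denseRange
    {𝕜 : Type*} [RCLike 𝕜] {V : Type*} [NormedAddCommGroup V] [NormedSpace 𝕜 V]
    (V₀ W : Submodule 𝕜 V)
    (hV₀ : Dense (V₀ : Set V))
    (hW : IsClosed (W : Set V))
    (hVW : closure ((V₀ ⊓ W : Submodule 𝕜 V) : Set V) = (W : Set V)) :
    (∀ x : V₀ ⧸ (W.comap V₀.subtype),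
        ‖(Submodule.mapQ (W.comap V₀.subtype) W V₀.subtype le_rfl) x‖ = ‖x‖) ∧
    DenseRange (Submodule.mapQ (W.comap V₀.subtype) W V₀.subtype le_rfl) := by
  constructor
  · intro x
    obtain ⟨v, rfl⟩ := Submodule.Quotient.mk_surjective _ x
    have himage : V₀.subtypeₗᵢ '' (W.comap V₀.subtype : Set V₀) =
        ((V₀ ⊓ W : Submodule 𝕜 V) : Set V) := by
      ext y
      simp [and_comm]
    rw [Submodule.mapQ_apply]
    calc ‖(Submodule.Quotient.mk (V₀.subtype v) : V ⧸ W)‖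
        = Metric.infDist (v : V) W := QuotientAddGroup.norm_mk (S := W.toAddSubgroup) (v : V)
      _ = Metric.infDist (v : V) ((V₀ ⊓ W : Submodule 𝕜 V) : Set V) := by
        rw [← hVW, Metric.infDist_closure]
      _ = Metric.infDist v (W.comap V₀.subtype : Set V₀) := by
        rw [← himage]
        exact Metric.infDist_image V₀.subtypeₗᵢ.isometry
      _ = ‖(Submodule.Quotient.mk v : V₀ ⧸ W.comap V₀.subtype)‖ :=
        (QuotientAddGroup.norm_mk (S := (W.comap V₀.subtype).toAddSubgroup) v).symm
  · have hmk : DenseRange (W.mkQ ∘ V₀.subtype) :=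
      W.mkQ_surjective.denseRange.comp (by simpa [DenseRange] using hV₀) continuous_quot_mk
    refine hmk.mono ?_
    rintro _ ⟨v, rfl⟩
    exact ⟨Submodule.Quotient.mk v, rfl⟩
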